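/- Let G be a connected simple graph, let x, y, z be three pairwise adjacent vertices of G, let S = {x,y,z}, and let k be a natural number. Suppose there exist vertices v₁ and v₂, both quasi-eccentric to S, with d(v₁,x) = k+1, d(v₁,y) = d(v₁,z) = k+2, and d(v₂,y) = k+1, d(v₂,x) = d(v₂,z) = k+2. Then (i) for any two distinct vertices s, t ∈ {x,y,z}, there is no vertex u quasi-eccentric to S with d(u,s) = d(u,t) = k; and (ii) if moreover k = min_{w ∈ qcc(S)} d(w,S), then there exists a vertex u quasi-eccentric to S with d(u,z) = k and d(u,x) = d(u,y) = k+1. -/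

import Mathlib

/-- The set of vertices of `G` quasi-eccentric to `S`. -/
def SimpleGraph.qcc {V : Type*} (G : SimpleGraph V) (S : Set V) : Set V :=
  {u : V | ∀ v : V, ∃ s ∈ S, G.dist v s ≤ G.dist u s}

/-- In a connected graph, distances from `u` to the endpoints of an edge differ by at most one. -/
theorem SimpleGraph.Connected.dist_le_dist_add_one_of_adj {V : Type*} {G : SimpleGraph V}
    (hG : G.Connected) {a b : V} (hab : G.Adj a b) (u : V) : G.dist u b ≤ G.dist u a + 1 := by
  simpa [SimpleGraph.dist_eq_one_iff_adj.mpr hab] using hG.dist_triangle (u := u) (v := a) (w := b)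

/-- Membership in `qcc` of a triple, spelled out. -/
theorem SimpleGraph.mem_qcc_triple {V : Type*} {G : SimpleGraph V} {x y z u : V} :
    u ∈ G.qcc {x, y, z} ↔ ∀ v, G.dist v x ≤ G.dist u x ∨ G.dist v y ≤ G.dist u y ∨
      G.dist v z ≤ G.dist u z := by
  simp [SimpleGraph.qcc]

/-- If `qcc S` and `S` are nonempty, the quasi-eccentricity is attained. -/
theorem SimpleGraph.exists_mem_qcc_dist_eq_sInf {V : Type*} {G : SimpleGraph V} {S : Set V}
    (hq : (G.qcc S).Nonempty) (hS : S.Nonempty) :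
    ∃ u ∈ G.qcc S, ∃ s ∈ S, G.dist u s = sInf ((fun w => sInf (G.dist w '' S)) '' G.qcc S) ∧
      ∀ t ∈ S, G.dist u s ≤ G.dist u t := by
  obtain ⟨u, hu, hmin⟩ := Nat.sInf_mem (hq.image fun w => sInf (G.dist w '' S))
  obtain ⟨s, hs, hus⟩ := Nat.sInf_mem (hS.image (G.dist u))
  exact ⟨u, hu, s, hs, hus.trans hmin, fun t ht =>
    hus.trans_le (Nat.sInf_le (Set.mem_image_of_mem _ ht))⟩

/-- Let `G` be a (finite) connected simple graph, `x, y, z` three pairwise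
adjacent vertices, `S = {x,y,z}` and `k : ℕ`.  Suppose there are vertices `v₁, v₂`, both
quasi-eccentric to `S`, with `d(v₁,x) = k+1`, `d(v₁,y) = d(v₁,z) = k+2`, `d(v₂,y) = k+1`
and `d(v₂,x) = d(v₂,z) = k+2`.  Then (i) for any two distinct `s, t ∈ {x,y,z}` there is no
vertex `u` quasi-eccentric to `S` with `d(u,s) = d(u,t) = k`; and (ii) if moreover
`k = min_{w ∈ qcc(S)} d(w,S)`, then there is a vertex `u` quasi-eccentric to `S` with
`d(u,z) = k` and `d(u,x) = d(u,y) = k+1`. -/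
theorem two_far_quasiEccentric_consequences {V : Type*} [Fintype V] (G : SimpleGraph V)
    (hG : G.Connected)
    (x y z : V) (hxy : G.Adj x y) (hyz : G.Adj y z) (hxz : G.Adj x z)
    (S : Set V) (hS : S = {x, y, z}) (k : ℕ)
    (hv₁ : ∃ v₁ ∈ G.qcc S, G.dist v₁ x = k + 1 ∧ G.dist v₁ y = k + 2 ∧ G.dist v₁ z = k + 2)
    (hv₂ : ∃ v₂ ∈ G.qcc S, G.dist v₂ y = k + 1 ∧ G.dist v₂ x = k + 2 ∧ G.dist v₂ z = k + 2) :
    (∀ s ∈ S, ∀ t ∈ S, s ≠ t →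
      ¬ ∃ u ∈ G.qcc S, G.dist u s = k ∧ G.dist u t = k) ∧
    (k = sInf ((fun w => sInf (G.dist w '' S)) '' G.qcc S) →
      ∃ u ∈ G.qcc S, G.dist u z = k ∧ G.dist u x = k + 1 ∧ G.dist u y = k + 1) := by
  subst hS
  obtain ⟨v₁, hv₁, h₁x, h₁y, h₁z⟩ := hv₁
  obtain ⟨v₂, -, h₂y, h₂x, h₂z⟩ := hv₂
  have hdist (u : V) :
      G.dist u x ≤ G.dist u y + 1 ∧ G.dist u y ≤ G.dist u x + 1 ∧
      G.dist u y ≤ G.dist u z + 1 ∧ G.dist u z ≤ G.dist u y + 1 ∧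
      G.dist u x ≤ G.dist u z + 1 ∧ G.dist u z ≤ G.dist u x + 1 :=
    ⟨hG.dist_le_dist_add_one_of_adj hxy.symm u, hG.dist_le_dist_add_one_of_adj hxy u,
      hG.dist_le_dist_add_one_of_adj hyz.symm u, hG.dist_le_dist_add_one_of_adj hyz u,
      hG.dist_le_dist_add_one_of_adj hxz.symm u, hG.dist_le_dist_add_one_of_adj hxz u⟩
  constructor
  · rintro s hs t ht hst ⟨u, hu, hus, hut⟩
    have hu₁ := SimpleGraph.mem_qcc_triple.mp hu v₁
    have hu₂ := SimpleGraph.mem_qcc_triple.mp hu v₂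
    have hd := hdist u
    rcases hs with rfl | rfl | rfl <;> rcases ht with rfl | rfl | rfl <;>
      first | exact hst rfl | omega
  · intro hk
    obtain ⟨u, hu, s, hs, hus, hmin⟩ :=
      SimpleGraph.exists_mem_qcc_dist_eq_sInf ⟨v₁, hv₁⟩ ⟨x, Set.mem_insert x _⟩
    rw [← hk] at hus
    have hu₁ := SimpleGraph.mem_qcc_triple.mp hu v₁
    have hu₂ := SimpleGraph.mem_qcc_triple.mp hu v₂
    have hd := hdist u
    have hx := hmin x (by simp)
    have hy := hmin y (by simp)
    have hz := hmin z (by simp)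
    refine ⟨u, hu, ?_⟩
    rcases hs with rfl | rfl | rfl <;> omega
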